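/- Let L₁, L be real numbers with 0 < L₁ ≤ L/2, set α := L₁/L and suppose α is irrational; define ξ_n = 2|αn − ⌊αn + 1/2⌋|. Let (ω_n⁺)_{n≥1} and (ω_n⁻)_{n≥1} be sequences of negative reals such that for every n ≥ 1 there exist k⁺, k⁻ ∈ (1/√2, 1) with S(k⁺) = L·√(−ω_n⁺)/n, φ(k⁺) = ξ_n, S(k⁻) = L·√(−ω_n⁻)/n and φ(k⁻) = 1 − ξ_n. Then the sequence (ω_n⁺) has a cluster point lying in the interval [−K(1/√2)⁴/L², 0], and the sequence (ω_n⁻) has a cluster point lying in the interval [−16·K(1/√2)⁴/(5L²), 0]. -/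

import Mathlib

open Real Filter Set

/-- Complete elliptic integral of the first kind. -/
noncomputable def Kell (k : ℝ) : ℝ :=
  ∫ t in (0:ℝ)..1, 1 / Real.sqrt ((1 - t^2) * (1 - k^2 * t^2))

/-- S(k) = 4√(2k²−1)·K(k). -/
noncomputable def Sfun (k : ℝ) : ℝ := 4 * Real.sqrt (2 * k^2 - 1) * Kell k

/-- H(k), the numerator in the definition of φ. -/
noncomputable def Hfun (k : ℝ) : ℝ :=
  ∫ t in Real.sqrt ((2 * k^2 - 1) / k^2)..1,
    1 / Real.sqrt ((1 - t^2) * (1 - k^2 * (1 - t^2)))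

/-- φ(k) = H(k)/K(k). -/
noncomputable def phiFun (k : ℝ) : ℝ := Hfun k / Kell k

/-- ξ_n = 2|αn − ⌊αn + 1/2⌋|. -/
noncomputable def xiSeq (α : ℝ) (n : ℕ) : ℝ :=
  2 * |α * n - (⌊α * n + 1/2⌋ : ℝ)|

/-- Two consecutive continued fraction convergents of `α`, of arbitrarily large denominators. -/
lemma exists_consecutive_convergents {α : ℝ} (hirr : Irrational α) (N : ℕ) :
    ∃ (σ p q p' q' : ℤ), (σ = 1 ∨ σ = -1) ∧ 0 ≤ q ∧ q ≤ q' ∧ 1 ≤ q' ∧ (N : ℤ) ≤ q + q' ∧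
      0 < σ * (p' - q' * α) ∧ σ * (p' - q' * α) < σ * (q * α - p) ∧
      σ * (q * p' - q' * p) = 1 := by
  induction N with
  | zero =>
    refine ⟨-1, 1, 0, ⌊α⌋, 1, Or.inr rfl, le_rfl, zero_le_one, le_rfl, by simp, ?_, ?_, by simp⟩
    · have h := (hirr.ne_int ⌊α⌋).symm.lt_of_le (Int.floor_le α)
      push_cast
      linarith
    · have h := Int.lt_floor_add_one α
      push_cast
      linarith
  | succ N ih =>
    obtain ⟨σ, p, q, p', q', hσ, hq, hqq, hq', hN, hpos, hlt, hdet⟩ := ih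
    set d' : ℝ := σ * (p' - q' * α) with hd'
    set d : ℝ := σ * (q * α - p) with hd
    set j : ℤ := ⌊d / d'⌋ with hj
    have hj1 : 1 ≤ j := by
      rw [hj, Int.le_floor, Int.cast_one, one_le_div hpos]
      exact hlt.le
    have hle : j * d' ≤ d := by
      rw [← le_div_iff₀ hpos]
      exact Int.floor_le _
    have hlt' : d < (j + 1) * d' := by
      rw [← div_lt_iff₀ hpos]
      exact Int.lt_floor_add_one _
    have hq'' : 1 ≤ q + j * q' := by nlinarith
    have hne : d ≠ j * d' := by
      intro h
      apply (hirr.intCast_mul (m := q + j * q') (by omega)).ne_int (p + j * p')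
      have hσ0 : (σ : ℝ) ≠ 0 := by rcases hσ with rfl | rfl <;> simp
      apply mul_left_cancel₀ hσ0
      push_cast
      linear_combination h
    have hlt'' := lt_of_le_of_ne hle hne.symm
    refine ⟨-σ, p', q', p + j * p', q + j * q', ?_, by omega, by nlinarith, hq'', ?_, ?_, ?_, ?_⟩
    · rcases hσ with rfl | rfl <;> simp
    · push_cast
      nlinarith
    · push_cast
      linarith
    · push_cast
      linarith
    · linear_combination hdet

lemma abs_eq_mul_of_sign {σ : ℤ} (hσ : σ = 1 ∨ σ = -1) (x : ℝ) : |(σ : ℝ) * x| = |x| := by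
  rcases hσ with rfl | rfl <;> simp

/-- A form of `exists_consecutive_convergents` in which the errors are small. -/
lemma exists_convergents_lt {α : ℝ} (hirr : Irrational α) {ε : ℝ} (hε : 0 < ε) :
    ∃ (σ p q p' q' : ℤ), (σ = 1 ∨ σ = -1) ∧ 0 < q ∧ q ≤ q' ∧
      0 < σ * (p' - q' * α) ∧ σ * (p' - q' * α) < σ * (q * α - p) ∧ σ * (q * α - p) < ε ∧
      σ * (q * p' - q' * p) = 1 := by
  obtain ⟨N, hN⟩ := exists_nat_gt (2 / ε)
  obtain ⟨σ, p, q, p', q', hσ, hq, hqq, hq', hNq, hpos, hlt, hdet⟩ :=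
    exists_consecutive_convergents hirr (N + 2)
  push_cast at hNq
  have hq_pos : 0 < q := by
    refine lt_of_le_of_ne hq fun h0 => ?_
    have hdvd : q' ∣ 1 := ⟨-(σ * p), by rw [← hdet, ← h0]; ring⟩
    have := Int.le_of_dvd one_pos hdvd
    omega
  refine ⟨σ, p, q, p', q', hσ, hq_pos, hqq, hpos, hlt, ?_, hdet⟩
  have hdet' : (σ : ℝ) * (q * p' - q' * p) = 1 := mod_cast hdet
  have hq0 : (0 : ℝ) ≤ q := mod_cast hq
  have hq1 : (1 : ℝ) ≤ q' := mod_cast hq'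
  have hNq' : (N : ℝ) ≤ 2 * q' := by
    have : (N : ℤ) ≤ 2 * q' := by omega
    exact_mod_cast this
  have key : q' * (σ * (q * α - p)) + q * (σ * (p' - q' * α)) = 1 := by
    linear_combination hdet'
  have h1 : q' * (σ * (q * α - p)) ≤ 1 := by
    nlinarith [mul_nonneg hq0 hpos.le]
  rw [div_lt_iff₀ hε] at hN
  by_contra! h
  nlinarith

lemma hurwitz_aux {q q' d d' s : ℝ} (hs : s ^ 2 = 5) (hq : 0 ≤ q) (hq' : 0 ≤ q')
    (h : q' * d + q * d' = 1) :
    s * (q * d) ≤ 1 ∨ s * (q' * d') ≤ 1 ∨ s * ((q + q') * (d - d')) ≤ 1 := by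
  by_contra! hcon
  obtain ⟨h1, h2, h3⟩ := hcon
  have hq0 : 0 < q := by
    rcases hq.eq_or_lt with rfl | h0
    · norm_num at h1
    · exact h0
  have hq0' : 0 < q' := by
    rcases hq'.eq_or_lt with rfl | h0
    · norm_num at h2
    · exact h0
  have hA : q ^ 2 + q' ^ 2 < s * (q * q') := by
    nlinarith [mul_lt_mul_of_pos_left h1 (pow_pos hq0' 2), mul_lt_mul_of_pos_left h2 (pow_pos hq0 2),
      mul_pos hq0 hq0']
  have hB : q' ^ 2 + (q + q') ^ 2 < s * (q' * (q + q')) := by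
    have e : s * (q' * (q + q')) =
      s * ((q + q') * (d - d')) * q' ^ 2 + s * (q' * d') * (q + q') ^ 2 := by
      linear_combination (-(s * (q' * (q + q')))) * h
    have := mul_lt_mul_of_pos_right h3 (pow_pos hq0' 2)
    have := mul_lt_mul_of_pos_right h2 (pow_pos (add_pos hq0 hq0') 2)
    linarith
  nlinarith [sq_nonneg ((s - 1) * q' - 2 * q)]

/-- Hurwitz' theorem, with arbitrarily small errors. -/
lemma exists_hurwitz {α : ℝ} (hirr : Irrational α) {ε : ℝ} (hε : 0 < ε) :
    ∃ p q : ℤ, 0 < q ∧ |q * α - p| < ε ∧ √5 * (q * |q * α - p|) ≤ 1 := by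
  obtain ⟨σ, p, q, p', q', hσ, hq, hqq, hpos, hlt, hsm, hdet⟩ := exists_convergents_lt hirr hε
  have hdet' : (σ : ℝ) * (q * p' - q' * p) = 1 := mod_cast hdet
  have hq0 : (0 : ℝ) ≤ q := mod_cast hq.le
  have hq1 : (0 : ℝ) ≤ q' := mod_cast hq.le.trans hqq
  have key : q' * (σ * (q * α - p)) + q * (σ * (p' - q' * α)) = 1 := by
    linear_combination hdet'
  have e1 : |q * α - p| = σ * (q * α - p) := by
    rw [← abs_eq_mul_of_sign hσ, abs_of_pos (hpos.trans hlt)]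
  have e2 : |q' * α - p'| = σ * (p' - q' * α) := by
    rw [abs_sub_comm, ← abs_eq_mul_of_sign hσ, abs_of_pos hpos]
  have e3 : |((q + q' : ℤ) : ℝ) * α - ((p + p' : ℤ) : ℝ)| =
      σ * (q * α - p) - σ * (p' - q' * α) := by
    rw [← abs_eq_mul_of_sign hσ, ← abs_of_pos (sub_pos.2 hlt)]
    congr 1
    push_cast
    ring
  rcases hurwitz_aux (Real.sq_sqrt (by norm_num : (0 : ℝ) ≤ 5)) hq0 hq1 key
    with h | h | h
  · exact ⟨p, q, hq, by rwa [e1], by rwa [e1]⟩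
  · exact ⟨p', q', hq.trans_le hqq, by rw [e2]; linarith, by rwa [e2]⟩
  · exact ⟨p + p', q + q', by omega, by rw [e3]; linarith, by rw [e3]; push_cast; exact h⟩

lemma scott_aux {q q' d d' : ℝ} (hq : 0 ≤ q) (hd' : 0 < d') (h : q' * d + q * d' = 1) :
    (q + q') * (d - d') ≤ 1 ∨ (q' - q) * (d + d') ≤ 1 := by
  by_contra! hcon
  nlinarith [mul_nonneg hq hd'.le]

/-- Approximation by fractions with odd numerator and even denominator. -/
lemma exists_odd_div_even {α : ℝ} (hirr : Irrational α) {ε : ℝ} (hε : 0 < ε) :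
    ∃ p n : ℤ, 0 ≤ n ∧ |2 * n * α - (2 * p + 1)| < ε ∧ 2 * n * |2 * n * α - (2 * p + 1)| ≤ 1 := by
  suffices ∃ p q : ℤ, Odd p ∧ Even q ∧ 0 ≤ q ∧ |q * α - p| < ε ∧ q * |q * α - p| ≤ 1 by
    obtain ⟨p, q, ⟨m, rfl⟩, ⟨n, rfl⟩, hq, h1, h2⟩ := this
    rw [← two_mul] at hq h1 h2
    push_cast at h1 h2
    exact ⟨m, n, by omega, h1, h2⟩
  obtain ⟨σ, p, q, p', q', hσ, hq, hqq, hpos, hlt, hsm, hdet⟩ :=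
    exists_convergents_lt hirr (half_pos hε)
  have hdet' : (σ : ℝ) * (q * p' - q' * p) = 1 := mod_cast hdet
  have hq0 : (0 : ℝ) ≤ q := mod_cast hq.le
  have hqq1 : (q : ℝ) ≤ q' := mod_cast hqq
  have hq1 : (0 : ℝ) ≤ q' := hq0.trans hqq1
  have key : q' * (σ * (q * α - p)) + q * (σ * (p' - q' * α)) = 1 := by
    linear_combination hdet'
  have e1 : |q * α - p| = σ * (q * α - p) := by
    rw [← abs_eq_mul_of_sign hσ, abs_of_pos (hpos.trans hlt)]
  have e2 : |q' * α - p'| = σ * (p' - q' * α) := by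
    rw [abs_sub_comm, ← abs_eq_mul_of_sign hσ, abs_of_pos hpos]
  have e3 : |((q + q' : ℤ) : ℝ) * α - ((p + p' : ℤ) : ℝ)| =
      σ * (q * α - p) - σ * (p' - q' * α) := by
    rw [← abs_eq_mul_of_sign hσ, ← abs_of_pos (sub_pos.2 hlt)]
    congr 1
    push_cast
    ring
  have e4 : |((q' - q : ℤ) : ℝ) * α - ((p' - p : ℤ) : ℝ)| =
      σ * (q * α - p) + σ * (p' - q' * α) := by
    rw [abs_sub_comm, ← abs_eq_mul_of_sign hσ, ← abs_of_pos (add_pos (hpos.trans hlt) hpos)]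
    congr 1
    push_cast
    ring
  have hodd : Odd (q * p' - q' * p) := by
    rcases hσ with rfl | rfl
    · exact ⟨0, by linarith⟩
    · exact ⟨-1, by linarith⟩
  generalize (σ : ℝ) * (q * α - p) = d at *
  generalize (σ : ℝ) * (p' - q' * α) = d' at *
  by_cases hqe : Even q
  · refine ⟨p, q, ?_, hqe, hq.le, by rw [e1]; linarith, by rw [e1]; nlinarith [mul_nonneg hq0 hpos.le]⟩
    by_contra hp
    rw [Int.not_odd_iff_even] at hp
    exact Int.not_even_iff_odd.2 hodd ((hqe.mul_right _).sub (hp.mul_left _))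
  by_cases hqe' : Even q'
  · refine ⟨p', q', ?_, hqe', by omega, by rw [e2]; linarith,
      by rw [e2]; nlinarith [mul_nonneg hq0 hpos.le]⟩
    by_contra hp
    rw [Int.not_odd_iff_even] at hp
    exact Int.not_even_iff_odd.2 hodd ((hp.mul_left _).sub (hqe'.mul_right _))
  rw [Int.not_even_iff_odd] at hqe hqe'
  have hpp : Odd (p' - p) := by
    simpa [Int.odd_sub, Int.odd_mul, Int.even_mul, hqe, Int.not_even_iff_odd.2 hqe'] using hodd
  rcases scott_aux hq0 hpos key with h | h
  · refine ⟨p + p', q + q', ?_, hqe.add_odd hqe', by omega, by rw [e3]; linarith,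
      by rw [e3]; push_cast; exact h⟩
    convert hpp.add_even (even_two_mul p) using 1
    ring
  · exact ⟨p' - p, q' - q, hpp, hqe'.sub_odd hqe, by omega, by rw [e4]; linarith,
      by rw [e4]; push_cast; exact h⟩

/-- Good approximations with arbitrarily small errors have arbitrarily large denominators. -/
lemma frequently_of_small_error {P : ℕ → Prop} {f : ℕ → ℝ} (hf : ∀ n, 1 ≤ n → 0 < f n)
    (h : ∀ ε > 0, ∃ n, 1 ≤ n ∧ f n < ε ∧ P n) : ∃ᶠ n in atTop, P n := by
  rw [frequently_atTop]
  intro N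
  have hmin : ∀ᶠ ε : ℝ in nhdsWithin 0 (Ioi 0), ∀ n ∈ Finset.Ico 1 N, ε < f n := by
    rw [Filter.eventually_all_finset]
    exact fun n hn => Filter.Eventually.filter_mono nhdsWithin_le_nhds
      (eventually_lt_nhds (hf n (Finset.mem_Ico.1 hn).1))
  obtain ⟨ε, hε, hε0⟩ := (hmin.and self_mem_nhdsWithin).exists
  obtain ⟨n, hn1, hn, hP⟩ := h ε hε0
  refine ⟨n, ?_, hP⟩
  by_contra! hlt
  exact absurd hn (hε n (Finset.mem_Ico.2 ⟨hn1, hlt⟩)).le.not_gt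

lemma one_div_sqrt_mul_le {a b c : ℝ} (ha : 0 ≤ a) (hc : 0 < c) (hcb : c ≤ b) :
    1 / √(a * b) ≤ (√c)⁻¹ * (√a)⁻¹ := by
  rw [Real.sqrt_mul ha, one_div, mul_inv, mul_comm]
  have : √c ≤ √b := Real.sqrt_le_sqrt hcb
  have : 0 < √c := Real.sqrt_pos.2 hc
  gcongr

lemma intervalIntegrable_inv_sqrt_one_sub_sq :
    IntervalIntegrable (fun t : ℝ => (√(1 - t ^ 2))⁻¹) MeasureTheory.volume 0 1 := by
  refine intervalIntegral.intervalIntegrable_deriv_of_nonneg (g := Real.arcsin)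
    Real.continuous_arcsin.continuousOn (fun x hx => ?_) (fun x _ => by positivity)
  have hx0 : 0 < x := by simpa using hx.1
  have hx1 : x < 1 := by simpa using hx.2
  simpa using Real.hasDerivAt_arcsin (by linarith) hx1.ne

lemma one_sub_sq_nonneg {t : ℝ} (ht : t ∈ Icc (0 : ℝ) 1) : 0 ≤ 1 - t ^ 2 := by
  nlinarith [ht.1, ht.2]

lemma intervalIntegrable_one_div_sqrt {w : ℝ → ℝ} (hw : Continuous w) {c : ℝ} (hc : 0 < c)
    (h : ∀ t ∈ Icc (0 : ℝ) 1, c ≤ w t) :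
    IntervalIntegrable (fun t : ℝ => 1 / √((1 - t ^ 2) * w t)) MeasureTheory.volume 0 1 := by
  refine (intervalIntegrable_inv_sqrt_one_sub_sq.const_mul (√c)⁻¹).mono_fun ?_ ?_
  · have := hw.measurable
    exact Measurable.aestronglyMeasurable (by fun_prop)
  · refine (MeasureTheory.ae_restrict_iff' measurableSet_uIoc).2 (Eventually.of_forall ?_)
    intro t ht
    rw [uIoc_of_le zero_le_one] at ht
    have ht' : t ∈ Icc (0 : ℝ) 1 := Ioc_subset_Icc_self ht
    beta_reduce
    rw [Real.norm_of_nonneg (by positivity), Real.norm_of_nonneg (by positivity)]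
    exact one_div_sqrt_mul_le (one_sub_sq_nonneg ht') hc (h t ht')

lemma intervalIntegrable_Kell {k : ℝ} (hk : k ^ 2 < 1) :
    IntervalIntegrable (fun t : ℝ => 1 / √((1 - t ^ 2) * (1 - k ^ 2 * t ^ 2)))
      MeasureTheory.volume 0 1 :=
  intervalIntegrable_one_div_sqrt (by fun_prop) (sub_pos.2 hk)
    (fun t ht => by nlinarith [one_sub_sq_nonneg ht, sq_nonneg k])

lemma intervalIntegrable_Hfun {k : ℝ} (hk : k ^ 2 < 1) :
    IntervalIntegrable (fun t : ℝ => 1 / √((1 - t ^ 2) * (1 - k ^ 2 * (1 - t ^ 2))))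
      MeasureTheory.volume 0 1 :=
  intervalIntegrable_one_div_sqrt (by fun_prop) (sub_pos.2 hk)
    (fun t ht => by nlinarith [mul_nonneg (sq_nonneg k) (sq_nonneg t)])

/-- The substitution `t ↦ √(1 - t²)` in the integral defining `Kell`. -/
lemma integral_eq_Kell (k : ℝ) :
    ∫ t in (0 : ℝ)..1, 1 / √((1 - t ^ 2) * (1 - k ^ 2 * (1 - t ^ 2))) = Kell k := by
  have hpos : ∀ t ∈ Ioo (0 : ℝ) 1, 0 < 1 - t ^ 2 := fun t ht => by nlinarith [ht.1, ht.2]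
  have hmem : ∀ t ∈ Ioo (0 : ℝ) 1, √(1 - t ^ 2) ∈ Ioo (0 : ℝ) 1 := fun t ht => by
    refine ⟨Real.sqrt_pos.2 (hpos t ht), ?_⟩
    rw [Real.sqrt_lt' one_pos]
    nlinarith [pow_pos ht.1 2]
  have hinv : ∀ t ∈ Ioo (0 : ℝ) 1, √(1 - √(1 - t ^ 2) ^ 2) = t := fun t ht => by
    rw [Real.sq_sqrt (hpos t ht).le, sub_sub_cancel, Real.sqrt_sq ht.1.le]
  have himage : (fun t : ℝ => √(1 - t ^ 2)) '' Ioo 0 1 = Ioo 0 1 := by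
    apply Subset.antisymm
    · rintro _ ⟨t, ht, rfl⟩
      exact hmem t ht
    · exact fun t ht => ⟨_, hmem t ht, hinv t ht⟩
  have hinj : InjOn (fun t : ℝ => √(1 - t ^ 2)) (Ioo 0 1) := fun a ha b hb hab => by
    rw [← hinv a ha, ← hinv b hb]
    simp only at hab
    rw [hab]
  have hderiv : ∀ t ∈ Ioo (0 : ℝ) 1, HasDerivWithinAt (fun t : ℝ => √(1 - t ^ 2))
      (-(2 * t) / (2 * √(1 - t ^ 2))) (Ioo 0 1) t := fun t ht => by
    have h : HasDerivAt (fun t : ℝ => 1 - t ^ 2) (-(2 * t)) t := by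
      simpa using (hasDerivAt_pow 2 t).const_sub 1
    exact (h.sqrt (hpos t ht).ne').hasDerivWithinAt
  have key := MeasureTheory.integral_image_eq_integral_abs_deriv_smul measurableSet_Ioo hderiv hinj
    (fun t => 1 / √((1 - t ^ 2) * (1 - k ^ 2 * (1 - t ^ 2))))
  rw [himage] at key
  rw [Kell, intervalIntegral.integral_of_le zero_le_one, intervalIntegral.integral_of_le zero_le_one,
    MeasureTheory.integral_Ioc_eq_integral_Ioo, MeasureTheory.integral_Ioc_eq_integral_Ioo, key]
  refine MeasureTheory.setIntegral_congr_fun measurableSet_Ioo fun t ht => ?_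
  have h0 := ht.1
  have hs : 0 < √(1 - t ^ 2) := (hmem t ht).1
  simp only [smul_eq_mul]
  rw [Real.sq_sqrt (hpos t ht).le, sub_sub_cancel, abs_div, abs_neg, abs_of_pos (by positivity),
    abs_of_pos (by positivity), Real.sqrt_mul (sq_nonneg t), Real.sqrt_sq h0.le,
    Real.sqrt_mul (hpos t ht).le]
  field_simp

section modulus

variable {k : ℝ}

lemma half_lt_sq (hk : k ∈ Ioo (1 / √2) 1) : 1 / 2 < k ^ 2 := by
  have h0 : (0 : ℝ) < 1 / √2 := by positivity
  have h : (1 / √2) ^ 2 = (1 / 2 : ℝ) := by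
    rw [div_pow, Real.sq_sqrt zero_le_two, one_pow]
  rw [← h]
  exact pow_lt_pow_left₀ hk.1 h0.le two_ne_zero

lemma modulus_pos (hk : k ∈ Ioo (1 / √2) 1) : 0 < k :=
  lt_trans (by positivity) hk.1

lemma sq_lt_one_of_mem (hk : k ∈ Ioo (1 / √2) 1) : k ^ 2 < 1 := by
  nlinarith [hk.2, modulus_pos hk]

lemma lower_limit_mem (hk : k ∈ Ioo (1 / √2) 1) : √((2 * k ^ 2 - 1) / k ^ 2) ∈ Icc (0 : ℝ) 1 := by
  refine ⟨Real.sqrt_nonneg _, ?_⟩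
  have := modulus_pos hk
  rw [Real.sqrt_le_iff, one_pow, div_le_one (by positivity)]
  refine ⟨zero_le_one, ?_⟩
  linarith [sq_lt_one_of_mem hk]

lemma Hfun_nonneg (hk : k ∈ Ioo (1 / √2) 1) : 0 ≤ Hfun k :=
  intervalIntegral.integral_nonneg (lower_limit_mem hk).2 fun _ _ => by positivity

/-- The elementary lower bound for `K - H`. -/
lemma two_mul_sqrt_le_Kell_sub_Hfun (hk : k ∈ Ioo (1 / √2) 1) :
    2 * √(2 * k ^ 2 - 1) ≤ Kell k - Hfun k := by
  have hk0 := modulus_pos hk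
  have hk1 := sq_lt_one_of_mem hk
  set s := √((2 * k ^ 2 - 1) / k ^ 2) with hs
  have hsI : s ∈ Icc (0 : ℝ) 1 := lower_limit_mem hk
  have hs1 : s < 1 := by
    rw [hs, Real.sqrt_lt' one_pos, div_lt_iff₀ (by positivity)]
    linarith
  have hint := intervalIntegrable_Hfun hk1
  have hint0 : IntervalIntegrable (fun t : ℝ => 1 / √((1 - t ^ 2) * (1 - k ^ 2 * (1 - t ^ 2))))
      MeasureTheory.volume 0 s := hint.mono_set (by
    rw [uIcc_of_le hsI.1, uIcc_of_le zero_le_one]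
    exact Icc_subset_Icc_right hsI.2)
  have hint1 : IntervalIntegrable (fun t : ℝ => 1 / √((1 - t ^ 2) * (1 - k ^ 2 * (1 - t ^ 2))))
      MeasureTheory.volume s 1 := hint.mono_set (by
    rw [uIcc_of_le hsI.2, uIcc_of_le zero_le_one]
    exact Icc_subset_Icc_left hsI.1)
  have hsplit := intervalIntegral.integral_add_adjacent_intervals hint0 hint1
  rw [integral_eq_Kell] at hsplit
  have hmono : ∫ _ in (0 : ℝ)..s, 2 * k ≤
      ∫ t in (0 : ℝ)..s, 1 / √((1 - t ^ 2) * (1 - k ^ 2 * (1 - t ^ 2))) := by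
    refine intervalIntegral.integral_mono_on hsI.1 (by simp) hint0 fun t ht => ?_
    have ht1 : 0 < 1 - t ^ 2 := by nlinarith [ht.1, ht.2]
    have hpos : 0 < (1 - t ^ 2) * (1 - k ^ 2 * (1 - t ^ 2)) :=
      mul_pos ht1 (by nlinarith [mul_nonneg (sq_nonneg k) (sq_nonneg t)])
    rw [le_div_iff₀ (Real.sqrt_pos.2 hpos)]
    have hle : √((1 - t ^ 2) * (1 - k ^ 2 * (1 - t ^ 2))) ≤ 1 / (2 * k) := by
      apply Real.sqrt_le_iff.2 ⟨by positivity, ?_⟩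
      rw [div_pow, le_div_iff₀ (by positivity)]
      nlinarith [sq_nonneg (1 - 2 * (k ^ 2 * (1 - t ^ 2)))]
    calc 2 * k * √((1 - t ^ 2) * (1 - k ^ 2 * (1 - t ^ 2))) ≤ 2 * k * (1 / (2 * k)) := by gcongr
      _ = 1 := by field_simp
  have hsk : s * k = √(2 * k ^ 2 - 1) := by
    rw [hs, Real.sqrt_div' _ (sq_nonneg k), Real.sqrt_sq hk0.le]
    field_simp
  rw [intervalIntegral.integral_const, smul_eq_mul, sub_zero] at hmono
  have : Hfun k = ∫ t in s..1, 1 / √((1 - t ^ 2) * (1 - k ^ 2 * (1 - t ^ 2))) := rfl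
  linarith

lemma Kell_pos (hk : k ∈ Ioo (1 / √2) 1) : 0 < Kell k := by
  have h1 := two_mul_sqrt_le_Kell_sub_Hfun hk
  have h2 := Hfun_nonneg hk
  have h3 : 0 < √(2 * k ^ 2 - 1) := Real.sqrt_pos.2 (by linarith [half_lt_sq hk])
  linarith

lemma two_mul_sqrt_le (hk : k ∈ Ioo (1 / √2) 1) :
    2 * √(2 * k ^ 2 - 1) ≤ Kell k * (1 - phiFun k) := by
  have h := (Kell_pos hk).ne'
  have e : Kell k * (1 - phiFun k) = Kell k - Hfun k := by
    rw [phiFun]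
    field_simp
  rw [e]
  exact two_mul_sqrt_le_Kell_sub_Hfun hk

lemma Hfun_le (hk : k ∈ Ioo (1 / √2) 1) :
    Hfun k ≤ (√(1 / 2))⁻¹ * ∫ t in (0 : ℝ)..1, (√(1 - t ^ 2))⁻¹ := by
  have hk0 := modulus_pos hk
  have hk1 := sq_lt_one_of_mem hk
  have hsI := lower_limit_mem hk
  have hsub : uIcc √((2 * k ^ 2 - 1) / k ^ 2) 1 ⊆ uIcc 0 1 := by
    rw [uIcc_of_le hsI.2, uIcc_of_le zero_le_one]
    exact Icc_subset_Icc_left hsI.1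
  rw [← intervalIntegral.integral_const_mul]
  calc Hfun k ≤ ∫ t in √((2 * k ^ 2 - 1) / k ^ 2)..1, (√(1 / 2))⁻¹ * (√(1 - t ^ 2))⁻¹ := by
        refine intervalIntegral.integral_mono_on hsI.2 ((intervalIntegrable_Hfun hk1).mono_set hsub)
          ((intervalIntegrable_inv_sqrt_one_sub_sq.const_mul _).mono_set hsub) fun t ht => ?_
        refine one_div_sqrt_mul_le (one_sub_sq_nonneg ⟨hsI.1.trans ht.1, ht.2⟩) (by norm_num) ?_
        have h := (Real.sqrt_le_left (hsI.1.trans ht.1)).1 ht.1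
        rw [div_le_iff₀ (by positivity)] at h
        linarith [half_lt_sq hk]
    _ ≤ ∫ t in (0 : ℝ)..1, (√(1 / 2))⁻¹ * (√(1 - t ^ 2))⁻¹ := by
        refine intervalIntegral.integral_mono_interval hsI.1 hsI.2 le_rfl
          (Eventually.of_forall fun t => ?_) (intervalIntegrable_inv_sqrt_one_sub_sq.const_mul _)
        simp only [Pi.zero_apply]
        positivity

/-- `Kell` is bounded where `phiFun` stays away from zero. -/
lemma exists_Kell_le : ∃ C : ℝ, 0 ≤ C ∧ ∀ k ∈ Ioo (1 / √2) 1, 1 / 2 ≤ phiFun k → Kell k ≤ C := by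
  refine ⟨2 * ((√(1 / 2))⁻¹ * ∫ t in (0 : ℝ)..1, (√(1 - t ^ 2))⁻¹), ?_, fun k hk h => ?_⟩
  · have : 0 ≤ ∫ t in (0 : ℝ)..1, (√(1 - t ^ 2))⁻¹ :=
      intervalIntegral.integral_nonneg zero_le_one fun t _ => by positivity
    positivity
  · rw [phiFun, le_div_iff₀ (Kell_pos hk)] at h
    linarith [Hfun_le hk]

lemma Kell_mul_sqrt_le (hk : k ∈ Ioo (1 / √2) 1) :
    Kell k * √(2 * (1 - k ^ 2)) ≤ Kell (1 / √2) := by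
  have hk1 := sq_lt_one_of_mem hk
  have hk2 := half_lt_sq hk
  have h0 : (1 / √2) ^ 2 = (1 / 2 : ℝ) := by
    rw [div_pow, Real.sq_sqrt zero_le_two, one_pow]
  rw [Kell, Kell, ← intervalIntegral.integral_mul_const]
  refine intervalIntegral.integral_mono_on zero_le_one ((intervalIntegrable_Kell hk1).mul_const _)
    (intervalIntegrable_Kell (by rw [h0]; norm_num)) fun t ht => ?_
  have ht0 := one_sub_sq_nonneg ht
  rcases ht0.eq_or_lt with h | ht1
  · simp [← h]
  have hr : 0 < 2 * (1 - k ^ 2) := by linarith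
  have hb : 0 < 1 - k ^ 2 * t ^ 2 := by nlinarith [sq_nonneg k]
  have hc : 0 < 1 - 1 / 2 * t ^ 2 := by nlinarith
  rw [h0, div_mul_eq_mul_div, one_mul, div_le_div_iff₀ (by positivity) (by positivity), one_mul,
    ← Real.sqrt_mul hr.le]
  apply Real.sqrt_le_sqrt
  nlinarith [mul_nonneg (mul_nonneg ht0 ht0) (by linarith : 0 ≤ 2 * k ^ 2 - 1)]

end modulus

lemma xiSeq_le (α : ℝ) (n : ℕ) (m : ℤ) : xiSeq α n ≤ 2 * |n * α - m| := by
  rw [xiSeq, ← round_eq, mul_comm α]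
  linarith [round_le ((n : ℝ) * α) m]

lemma one_sub_xiSeq_le (α : ℝ) (n : ℕ) (m : ℤ) :
    1 - xiSeq α n ≤ |2 * n * α - (2 * m + 1)| := by
  rw [xiSeq]
  generalize ⌊α * n + 1 / 2⌋ = r
  have h1 : (1 : ℝ) ≤ |((2 * r - (2 * m + 1) : ℤ) : ℝ)| := by
    rw [← Int.cast_abs]
    exact_mod_cast Int.one_le_abs (by omega)
  have h2 := abs_add_le (2 * (r - α * n)) (2 * n * α - (2 * m + 1))
  rw [show 2 * (r - α * n) + (2 * n * α - (2 * m + 1)) = ((2 * r - (2 * m + 1) : ℤ) : ℝ) by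
    push_cast; ring, abs_mul, abs_two, abs_sub_comm] at h2
  linarith

lemma xiSeq_pos {α : ℝ} (hirr : Irrational α) {n : ℕ} (hn : 1 ≤ n) : 0 < xiSeq α n := by
  have h := (hirr.mul_natCast (m := n) (by omega)).ne_int ⌊α * n + 1 / 2⌋
  exact mul_pos two_pos (abs_pos.2 (sub_ne_zero.2 h))

lemma one_sub_xiSeq_pos {α : ℝ} (hirr : Irrational α) {n : ℕ} (hn : 1 ≤ n) :
    0 < 1 - xiSeq α n := by
  have hle : |α * n - round (α * n)| ≤ 1 / 2 := abs_sub_round _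
  rw [round_eq] at hle
  rw [xiSeq]
  have hne : |α * n - (⌊α * n + 1 / 2⌋ : ℝ)| ≠ 1 / 2 := by
    intro h
    have hirr' := (hirr.mul_natCast (m := n) (by omega)).mul_natCast (m := 2) two_ne_zero
    rcases (abs_eq (by norm_num)).1 h with h | h
    · apply hirr'.ne_int (2 * ⌊α * n + 1 / 2⌋ + 1)
      push_cast
      linarith
    · apply hirr'.ne_int (2 * ⌊α * n + 1 / 2⌋ - 1)
      push_cast
      linarith
  linarith [lt_of_le_of_ne hle hne]

lemma frequently_mul_xiSeq_le {α : ℝ} (hirr : Irrational α) :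
    ∃ᶠ n : ℕ in atTop, n * xiSeq α n ≤ 2 / √5 := by
  refine frequently_of_small_error (fun n hn => xiSeq_pos hirr hn) fun ε hε => ?_
  obtain ⟨p, q, hq, hsm, hP⟩ := exists_hurwitz hirr (half_pos hε)
  lift q to ℕ using hq.le
  rw [Int.cast_natCast] at hsm hP
  have hle := xiSeq_le α q p
  refine ⟨q, by omega, by linarith, ?_⟩
  rw [le_div_iff₀ (by positivity)]
  have h5 : 0 ≤ √5 * q := by positivity
  nlinarith

lemma frequently_mul_one_sub_xiSeq_le {α : ℝ} (hirr : Irrational α) :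
    ∃ᶠ n : ℕ in atTop, n * (1 - xiSeq α n) ≤ 1 / 2 := by
  refine frequently_of_small_error (fun n hn => one_sub_xiSeq_pos hirr hn) fun ε hε => ?_
  obtain ⟨p, n, hn, hsm, hP⟩ := exists_odd_div_even hirr (lt_min hε one_pos)
  lift n to ℕ using hn
  rw [lt_min_iff] at hsm
  rw [Int.cast_natCast] at hsm hP
  have hle := one_sub_xiSeq_le α n p
  refine ⟨n, ?_, by linarith [hsm.1], ?_⟩
  · by_contra! h
    obtain rfl : n = 0 := by omega
    have h1 : (1 : ℝ) ≤ |((2 * p + 1 : ℤ) : ℝ)| := by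
      rw [← Int.cast_abs]
      exact_mod_cast Int.one_le_abs (by omega)
    have h2 := hsm.2
    rw [Nat.cast_zero, mul_zero, zero_mul, zero_sub, abs_neg] at h2
    push_cast at h1
    linarith
  · nlinarith [mul_le_mul_of_nonneg_left hle (Nat.cast_nonneg (α := ℝ) n)]

/-- The quantitative form of `S k ≲ 2 K(1/√2)² (1 - φ k)` as `φ k → 1`. -/
lemma neg_le_of_Sfun_eq_of_phiFun_eq {L B C ω ψ k x : ℝ} (hL : 0 < L) (hB : 0 ≤ B) (hC : 0 ≤ C)
    (hKC : 1 / 2 ≤ phiFun k → Kell k ≤ C) (hω : ω < 0) (hx : 0 < x) (hxB : 2 * B ≤ x)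
    (hxD : (C * B / 2) ^ 2 / x ^ 2 < 1) (hk : k ∈ Ioo (1 / √2) 1)
    (hS : Sfun k = L * √(-ω) / x) (hφ : phiFun k = ψ) (hψ : x * (1 - ψ) ≤ B) :
    -ω ≤ 4 * B ^ 2 * Kell (1 / √2) ^ 4 / L ^ 2 / (1 - (C * B / 2) ^ 2 / x ^ 2) ^ 2 := by
  subst hφ
  have hK0 := Kell_pos hk
  have hk1 := sq_lt_one_of_mem hk
  have hk2 := half_lt_sq hk
  have hK : Kell k ≤ C := hKC (by nlinarith)
  have hsqrt := two_mul_sqrt_le hk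
  have hs0 : 0 ≤ √(2 * k ^ 2 - 1) := Real.sqrt_nonneg _
  have hs2 : √(2 * k ^ 2 - 1) ^ 2 = 2 * k ^ 2 - 1 := Real.sq_sqrt (by linarith)
  have hφ0 : 0 ≤ 1 - phiFun k := by
    by_contra! h
    nlinarith
  set r := 1 - (C * B / 2) ^ 2 / x ^ 2 with hr
  have hr0 : 0 < r := sub_pos.2 hxD
  have hrk : r ≤ 2 * (1 - k ^ 2) := by
    have h1 : √(2 * k ^ 2 - 1) ≤ C * B / 2 / x := by
      rw [le_div_iff₀ hx]
      nlinarith [mul_le_mul hK hψ (by positivity) hC]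
    have h2 := pow_le_pow_left₀ hs0 h1 2
    rw [hs2, div_pow] at h2
    linarith
  have hKr : Kell k ^ 2 * r ≤ Kell (1 / √2) ^ 2 := by
    have h := pow_le_pow_left₀ (by positivity) (Kell_mul_sqrt_le hk) 2
    rw [mul_pow, Real.sq_sqrt (by linarith)] at h
    nlinarith [sq_nonneg (Kell k)]
  have hmain : L * √(-ω) ≤ 2 * B * Kell k ^ 2 := by
    rw [eq_div_iff hx.ne', Sfun] at hS
    rw [← hS]
    calc 4 * √(2 * k ^ 2 - 1) * Kell k * x = 2 * x * Kell k * (2 * √(2 * k ^ 2 - 1)) := by ring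
      _ ≤ 2 * x * Kell k * (Kell k * (1 - phiFun k)) := by gcongr
      _ = 2 * Kell k ^ 2 * (x * (1 - phiFun k)) := by ring
      _ ≤ 2 * Kell k ^ 2 * B := by gcongr
      _ = 2 * B * Kell k ^ 2 := by ring
  have hmain' : L * √(-ω) * r ≤ 2 * B * Kell (1 / √2) ^ 2 := by
    calc L * √(-ω) * r ≤ 2 * B * Kell k ^ 2 * r := by gcongr
      _ = 2 * B * (Kell k ^ 2 * r) := by ring
      _ ≤ _ := by gcongr
  have hsq := pow_le_pow_left₀ (by positivity) hmain' 2
  rw [mul_pow, mul_pow, Real.sq_sqrt (by linarith)] at hsq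
  rw [le_div_iff₀ (by positivity), le_div_iff₀ (by positivity)]
  linarith

/-- Cluster points of `ω` when `φ` comes infinitely often `B / n`-close to `1`. -/
lemma exists_cluster_point {L B : ℝ} (hL : 0 < L) (hB : 0 ≤ B) {ω ψ : ℕ → ℝ}
    (hω : ∀ n : ℕ, 1 ≤ n → ω n < 0)
    (hk : ∀ n : ℕ, 1 ≤ n → ∃ k ∈ Set.Ioo (1 / Real.sqrt 2) 1,
      Sfun k = L * Real.sqrt (-(ω n)) / n ∧ phiFun k = ψ n)
    (hψ : ∃ᶠ n : ℕ in atTop, n * (1 - ψ n) ≤ B) :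
    ∃ c ∈ Set.Icc (-(4 * B ^ 2 * Kell (1 / √2) ^ 4 / L ^ 2)) 0,
      ∃ g : ℕ → ℕ, StrictMono g ∧ (∀ j, 1 ≤ g j) ∧
        Filter.Tendsto (fun j => ω (g j)) Filter.atTop (nhds c) := by
  obtain ⟨C, hC, hKC⟩ := exists_Kell_le
  set M := 4 * B ^ 2 * Kell (1 / √2) ^ 4 / L ^ 2 with hM
  have hD : Tendsto (fun n : ℕ => (C * B / 2) ^ 2 / (n : ℝ) ^ 2) atTop (nhds 0) :=
    ((tendsto_pow_atTop two_ne_zero).comp tendsto_natCast_atTop_atTop).const_div_atTop _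
  have hu : Tendsto (fun n : ℕ => M / (1 - (C * B / 2) ^ 2 / (n : ℝ) ^ 2) ^ 2) atTop (nhds M) := by
    have h := (tendsto_const_nhds (x := M)).div ((hD.const_sub 1).pow 2) (by norm_num)
    simpa [Pi.div_def] using h
  have hfreq : ∃ᶠ n : ℕ in atTop, 1 ≤ n ∧ ω n ∈ Icc (-(M + 1)) 0 ∧
      -(M / (1 - (C * B / 2) ^ 2 / (n : ℝ) ^ 2) ^ 2) ≤ ω n := by
    refine (hψ.and_eventually ((eventually_ge_atTop 1).and
      ((tendsto_natCast_atTop_atTop.eventually_ge_atTop (2 * B)).and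
        ((hD.eventually_lt_const one_pos).and
          (hu.eventually_lt_const (lt_add_one M)))))).mono ?_
    rintro n ⟨hn, hn1, hn2, hn3, hn4⟩
    obtain ⟨k, hkI, hS, hφ⟩ := hk n hn1
    have hle := neg_le_of_Sfun_eq_of_phiFun_eq hL hB hC (hKC k hkI) (hω n hn1) (by exact_mod_cast hn1) hn2
      hn3 hkI hS hφ hn
    exact ⟨hn1, ⟨by linarith, (hω n hn1).le⟩, by linarith⟩
  obtain ⟨g, hg, hgP⟩ := extraction_of_frequently_atTop hfreq
  obtain ⟨c, hc, i, hi, hlim⟩ := isCompact_Icc.tendsto_subseq fun n => (hgP n).2.1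
  refine ⟨c, ⟨?_, hc.2⟩, g ∘ i, hg.comp hi, fun j => (hgP (i j)).1, hlim⟩
  exact le_of_tendsto_of_tendsto' ((hu.comp (hg.comp hi).tendsto_atTop).neg) hlim
    fun j => (hgP (i j)).2.2

/-- (ω_n⁺) has a cluster point in [−K(1/√2)⁴/L², 0] and (ω_n⁻)
has a cluster point in [−16K(1/√2)⁴/(5L²), 0]. -/
theorem stmt_16 (L₁ L α : ℝ) (hL₁ : 0 < L₁) (hL : L₁ ≤ L / 2)
    (hα : α = L₁ / L) (hirr : Irrational α)
    (ωp ωm : ℕ → ℝ) (hωp : ∀ n : ℕ, 1 ≤ n → ωp n < 0) (hωm : ∀ n : ℕ, 1 ≤ n → ωm n < 0)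
    (hkp : ∀ n : ℕ, 1 ≤ n → ∃ k ∈ Set.Ioo (1 / Real.sqrt 2) 1,
      Sfun k = L * Real.sqrt (-(ωp n)) / n ∧ phiFun k = xiSeq α n)
    (hkm : ∀ n : ℕ, 1 ≤ n → ∃ k ∈ Set.Ioo (1 / Real.sqrt 2) 1,
      Sfun k = L * Real.sqrt (-(ωm n)) / n ∧ phiFun k = 1 - xiSeq α n) :
    (∃ c ∈ Set.Icc (-(Kell (1 / Real.sqrt 2) ^ 4) / L ^ 2) 0,
      ∃ g : ℕ → ℕ, StrictMono g ∧ (∀ j, 1 ≤ g j) ∧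
        Filter.Tendsto (fun j => ωp (g j)) Filter.atTop (nhds c)) ∧
    (∃ c ∈ Set.Icc (-(16 * Kell (1 / Real.sqrt 2) ^ 4) / (5 * L ^ 2)) 0,
      ∃ g : ℕ → ℕ, StrictMono g ∧ (∀ j, 1 ≤ g j) ∧
        Filter.Tendsto (fun j => ωm (g j)) Filter.atTop (nhds c)) := by
  have hL0 : 0 < L := by linarith
  have hp := exists_cluster_point hL0 (by norm_num) hωp hkp (frequently_mul_one_sub_xiSeq_le hirr)
  have hm := exists_cluster_point (B := 2 / √5) hL0 (by positivity) hωm hkm (by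
    simpa only [sub_sub_cancel] using frequently_mul_xiSeq_le hirr)
  have e1 : -(4 * (1 / 2 : ℝ) ^ 2 * Kell (1 / √2) ^ 4 / L ^ 2) =
      -(Kell (1 / √2) ^ 4) / L ^ 2 := by ring
  have e2 : -(4 * (2 / √5) ^ 2 * Kell (1 / √2) ^ 4 / L ^ 2) =
      -(16 * Kell (1 / √2) ^ 4) / (5 * L ^ 2) := by
    rw [div_pow, Real.sq_sqrt (by norm_num)]
    field_simp
    ring
  rw [e1] at hp
  rw [e2] at hm
  exact ⟨hp, hm⟩
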